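/- Cardinality of abstractions: For any ADF F = (A,R,C) with |A| = k, the set Δ[F] of abstractions of F is nonempty and its cardinality is at most ((k+2)(k+3)/2)^(2k). -/

import Mathlib

inductive Label : Type
  | inn
  | out
  | undec
deriving DecidableEq

instance : Fintype Label where
  elems := Finset.mk [Label.inn, Label.out, Label.undec] (by decide)
  complete := by intro x; cases x <;> decide

inductive Kind : Type
  | must
  | mays
  | nott
deriving DecidableEq

structure Nuance : Type where
  n1 : ℕ
  n2 : ℕ
  m1 : ℕ
  m2 : ℕ
  hn : n1 ≤ n2
  hm : m1 ≤ m2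

variable {A : Type} [Fintype A] [DecidableEq A]

/-- The set of attackers of `a`. -/
def pre (R : A → A → Prop) [DecidableRel R] (a : A) : Finset A :=
  Finset.univ.filter (fun b => R b a)

/-- Number of `out`-labelled arguments in the domain of a labelling. -/
def oCount {S : Finset A} (lam : ↥S → Label) : ℕ :=
  (Finset.univ.filter (fun b : ↥S => lam b = Label.out)).card

/-- Number of `in`-labelled arguments in the domain of a labelling. -/
def iCount {S : Finset A} (lam : ↥S → Label) : ℕ :=
  (Finset.univ.filter (fun b : ↥S => lam b = Label.inn)).card

/-- `x`-acceptance conditions for `x ∈ {must, may_s, not}`. -/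
def satA (Q : Nuance) (o : ℕ) : Kind → Prop
  | Kind.must => Q.n2 ≤ o
  | Kind.mays => Q.n1 ≤ o ∧ o < Q.n2
  | Kind.nott => o < Q.n1

/-- `y`-rejection conditions for `y ∈ {must, may_s, not}`. -/
def satR (Q : Nuance) (i : ℕ) : Kind → Prop
  | Kind.must => Q.m2 ≤ i
  | Kind.mays => Q.m1 ≤ i ∧ i < Q.m2
  | Kind.nott => i < Q.m1

/-- Label designation as a function of the nuance tuple and the counts `o`, `i`. -/
def designatesN (Q : Nuance) (o i : ℕ) (l : Label) : Prop :=
  (l = Label.inn ∧ Q.n1 ≤ o ∧ ¬ Q.m2 ≤ i) ∨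
  (l = Label.out ∧ Q.m1 ≤ i ∧ ¬ Q.n2 ≤ o) ∨
  (l = Label.undec ∧
    ((Q.n2 ≤ o ∧ Q.m2 ≤ i) ∨
     ((Q.n1 ≤ o ∧ o < Q.n2) ∨ (Q.m1 ≤ i ∧ i < Q.m2)) ∨
     (o < Q.n1 ∧ i < Q.m1)))

/-- `lam` designates `l` for `a` in the MMA `(A, R, fQ)`. -/
def designatesMMA (R : A → A → Prop) [DecidableRel R] (fQ : A → Nuance)
    (a : A) (lam : ↥(pre R a) → Label) (l : Label) : Prop :=
  designatesN (fQ a) (oCount lam) (iCount lam) l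

/-- The ADF `(A, R, C)` is a concretisation of the MMA `(A, R, fQ)`. -/
def IsConcretisation (R : A → A → Prop) [DecidableRel R]
    (C : ∀ a : A, (↥(pre R a) → Label) → Label) (fQ : A → Nuance) : Prop :=
  ∀ (a : A) (lam : ↥(pre R a) → Label), designatesMMA R fQ a lam (C a lam)

/-- Γ[fQ]: the set of all concretisations of the MMA `(A, R, fQ)`. -/
def Gamma (R : A → A → Prop) [DecidableRel R] (fQ : A → Nuance) :
    Set (∀ a : A, (↥(pre R a) → Label) → Label) :=
  {C | IsConcretisation R C fQ}

/-- The MMA `(A, R, fQ)` is an abstraction of the ADF `(A, R, C)`. -/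
def IsAbstraction (R : A → A → Prop) [DecidableRel R] (fQ : A → Nuance)
    (C : ∀ a : A, (↥(pre R a) → Label) → Label) : Prop :=
  ∀ a : A,
    (fQ a).n2 ≤ (pre R a).card + 1 ∧ (fQ a).m2 ≤ (pre R a).card + 1 ∧
    ∀ lam : ↥(pre R a) → Label,
      (oCount lam < (fQ a).n1 → iCount lam < (fQ a).m1 → C a lam = Label.undec) ∧
      ((fQ a).n1 ≤ oCount lam → oCount lam < (fQ a).n2 → iCount lam < (fQ a).m1 →
        (C a lam = Label.inn ∨ C a lam = Label.undec)) ∧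
      ((fQ a).n2 ≤ oCount lam → iCount lam < (fQ a).m1 → C a lam = Label.inn) ∧
      (oCount lam < (fQ a).n1 → (fQ a).m1 ≤ iCount lam → iCount lam < (fQ a).m2 →
        (C a lam = Label.out ∨ C a lam = Label.undec)) ∧
      ((fQ a).n1 ≤ oCount lam → oCount lam < (fQ a).n2 → (fQ a).m1 ≤ iCount lam →
        iCount lam < (fQ a).m2 →
        (C a lam = Label.inn ∨ C a lam = Label.out ∨ C a lam = Label.undec)) ∧
      ((fQ a).n2 ≤ oCount lam → (fQ a).m1 ≤ iCount lam → iCount lam < (fQ a).m2 →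
        (C a lam = Label.inn ∨ C a lam = Label.undec)) ∧
      (oCount lam < (fQ a).n1 → (fQ a).m2 ≤ iCount lam → C a lam = Label.out) ∧
      ((fQ a).n1 ≤ oCount lam → oCount lam < (fQ a).n2 → (fQ a).m2 ≤ iCount lam →
        (C a lam = Label.out ∨ C a lam = Label.undec)) ∧
      ((fQ a).n2 ≤ oCount lam → (fQ a).m2 ≤ iCount lam → C a lam = Label.undec)

/-- Δ[C]: the set of all abstractions of the ADF `(A, R, C)`. -/
def Delta (R : A → A → Prop) [DecidableRel R]
    (C : ∀ a : A, (↥(pre R a) → Label) → Label) : Set (A → Nuance) :=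
  {fQ | IsAbstraction R fQ C}

/-- The abstract order `⊴` on nuance tuples. -/
def nuanceLE (Q Q' : Nuance) : Prop :=
  Q'.n1 ≤ Q.n1 ∧ Q.n2 ≤ Q'.n2 ∧ Q'.m1 ≤ Q.m1 ∧ Q.m2 ≤ Q'.m2

/-- The abstract order `⊑` on MMAs over the same `(A, R)`. -/
def mmaLE (fQ fQ' : A → Nuance) : Prop := ∀ a : A, nuanceLE (fQ a) (fQ' a)

/-- Strict abstract order `⊏` on MMAs. -/
def mmaLT (fQ fQ' : A → Nuance) : Prop := mmaLE fQ fQ' ∧ ¬ mmaLE fQ' fQ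

/-- The order `⊑` on sets of MMAs. -/
def setLE (X' X : Set (A → Nuance)) : Prop := ∀ G ∈ X', ∃ F ∈ X, mmaLE G F

/-- `f_γ` on sets of MMAs. -/
def fGamma (R : A → A → Prop) [DecidableRel R] (X : Set (A → Nuance)) :
    Set (∀ a : A, (↥(pre R a) → Label) → Label) :=
  ⋃ fQ ∈ X, Gamma R fQ

/-- `f_α` on sets of ADFs. -/
def fAlpha (R : A → A → Prop) [DecidableRel R]
    (Y : Set (∀ a : A, (↥(pre R a) → Label) → Label)) : Set (A → Nuance) :=
  ⋃ C ∈ Y, {fQ | fQ ∈ Delta R C ∧ ¬ ∃ fQ' ∈ Delta R C, mmaLT fQ' fQ}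

/-- `f_α({C})` for a single ADF. -/
def fAlphaSingle (R : A → A → Prop) [DecidableRel R]
    (C : ∀ a : A, (↥(pre R a) → Label) → Label) : Set (A → Nuance) :=
  {fQ | fQ ∈ Delta R C ∧ ¬ ∃ fQ' ∈ Delta R C, mmaLT fQ' fQ}

/-- Restriction of a total labelling to `pre(a)`. -/
def restrictTo (R : A → A → Prop) [DecidableRel R] (lam : A → Label) (a : A) :
    ↥(pre R a) → Label :=
  fun b => lam b.1

/-- `lam` is an exact labelling of the MMA `(A, R, fQ)`. -/
def ExactMMA (R : A → A → Prop) [DecidableRel R] (fQ : A → Nuance)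
    (lam : A → Label) : Prop :=
  ∀ a : A, designatesMMA R fQ a (restrictTo R lam a) (lam a)

/-- `lam` is an exact labelling of the ADF `(A, R, C)`. -/
def ExactADF (R : A → A → Prop) [DecidableRel R]
    (C : ∀ a : A, (↥(pre R a) → Label) → Label) (lam : A → Label) : Prop :=
  ∀ a : A, C a (restrictTo R lam a) = lam a

/-- The order `⪯` on total labellings. -/
def preceq (lam1 lam2 : A → Label) : Prop :=
  ∀ a : A, (lam1 a = Label.inn → lam2 a = Label.inn) ∧
    (lam1 a = Label.out → lam2 a = Label.out)

/-- `maxi_A(lam)`: the maximal labellings above `lam` in `⪯`. -/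
def maxi (lam : A → Label) : Set (A → Label) :=
  {lx | preceq lam lx ∧ ∀ ly : A → Label, preceq lx ly → preceq ly lx}

/-- Total-labelling designation in an MMA. -/
def desMMAtotal (R : A → A → Prop) [DecidableRel R] (fQ : A → Nuance)
    (a : A) (lam : A → Label) (l : Label) : Prop :=
  designatesMMA R fQ a (restrictTo R lam a) l

/-- Total-labelling designation in an ADF. -/
def desADFtotal (R : A → A → Prop) [DecidableRel R]
    (C : ∀ a : A, (↥(pre R a) → Label) → Label)
    (a : A) (lam : A → Label) (l : Label) : Prop :=
  C a (restrictTo R lam a) = l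

open Classical in
/-- The consensus operator `Θ^H`, parameterised by the designation relation of `H`. -/
noncomputable def theta (D : A → (A → Label) → Label → Prop) (lam : A → Label) :
    A → Label :=
  fun a =>
    if ∀ lx ∈ maxi lam, D a lx Label.inn ∧ ∀ l : Label, D a lx l → l = Label.inn then
      Label.inn
    else if ∀ lx ∈ maxi lam, D a lx Label.out ∧ ∀ l : Label, D a lx l → l = Label.out then
      Label.out
    else Label.undec

/-- `lam` is a `⪯`-least fixpoint of `Th`. -/
def IsLfp (Th : (A → Label) → (A → Label)) (lam : A → Label) : Prop :=
  Th lam = lam ∧ ∀ mu : A → Label, Th mu = mu → preceq lam mu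

/-- `a` is credulously accepted/rejected (label `l`) w.r.t. the set `S` of labellings. -/
def CredIn (S : Set (A → Label)) (a : A) (l : Label) : Prop :=
  ∃ lam ∈ S, lam a = l

/-- `a` is skeptically accepted/rejected (label `l`) w.r.t. the set `S` of labellings. -/
def SkepIn (S : Set (A → Label)) (a : A) (l : Label) : Prop :=
  CredIn S a l ∧ ∀ lam ∈ S, lam a = l

/-- Pairs `⟨x₂, x₁⟩` encoding the may-must scales with `x₁ ≤ x₂ ≤ k + 1`. -/
def boundedScales (k : ℕ) : Finset (Σ _ : ℕ, ℕ) :=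
  (Finset.range (k + 2)).sigma fun n => Finset.range (n + 1)

theorem mem_boundedScales {k x₁ x₂ : ℕ} (h : x₁ ≤ x₂) (h₂ : x₂ ≤ k + 1) :
    (⟨x₂, x₁⟩ : Σ _ : ℕ, ℕ) ∈ boundedScales k := by
  simp only [boundedScales, Finset.mem_sigma, Finset.mem_range]
  omega

theorem card_boundedScales (k : ℕ) :
    (boundedScales k).card = (k + 2) * (k + 3) / 2 := by
  simp only [boundedScales, Finset.card_sigma, Finset.card_range]
  have h := Finset.sum_range_succ' (fun i => i) (k + 2)
  rw [Finset.sum_range_id] at h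
  rw [← add_zero (∑ i ∈ Finset.range (k + 2), (i + 1)), ← h, mul_comm]
  rfl

/-- The two scales of a nuance tuple, each encoded as `⟨x₂, x₁⟩`. -/
def Nuance.scales (Q : Nuance) : (Σ _ : ℕ, ℕ) × (Σ _ : ℕ, ℕ) :=
  (⟨Q.n2, Q.n1⟩, ⟨Q.m2, Q.m1⟩)

theorem Nuance.scales_injective : Function.Injective Nuance.scales := by
  rintro ⟨⟩ ⟨⟩ h
  simp_all [Nuance.scales]

theorem oCount_le_card {B : Type} {S : Finset B} (lam : ↥S → Label) :
    oCount lam ≤ S.card :=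
  (Finset.card_filter_le _ _).trans (by simp)

theorem iCount_le_card {B : Type} {S : Finset B} (lam : ↥S → Label) :
    iCount lam ≤ S.card :=
  (Finset.card_filter_le _ _).trans (by simp)

theorem Delta_nonempty (R : A → A → Prop) [DecidableRel R]
    (C : ∀ a : A, (↥(pre R a) → Label) → Label) : (Delta R C).Nonempty := by
  refine ⟨fun a => ⟨0, (pre R a).card + 1, 0, (pre R a).card + 1, Nat.zero_le _, Nat.zero_le _⟩,
    fun a => ⟨le_rfl, le_rfl, fun lam => ?_⟩⟩
  have ho := Nat.lt_succ_of_le (oCount_le_card lam)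
  have hi := Nat.lt_succ_of_le (iCount_le_card lam)
  have hC : C a lam = Label.inn ∨ C a lam = Label.out ∨ C a lam = Label.undec := by
    cases C a lam <;> simp
  exact ⟨fun h => absurd h (Nat.not_lt_zero _), fun _ _ h => absurd h (Nat.not_lt_zero _),
    fun h => absurd h ho.not_ge, fun h => absurd h (Nat.not_lt_zero _), fun _ _ _ _ => hC,
    fun h => absurd h ho.not_ge, fun h => absurd h (Nat.not_lt_zero _),
    fun _ _ h => absurd h hi.not_ge, fun h => absurd h ho.not_ge⟩

theorem ncard_Delta_le (R : A → A → Prop) [DecidableRel R]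
    (C : ∀ a : A, (↥(pre R a) → Label) → Label) :
    (Delta R C).ncard ≤
      ((Fintype.card A + 2) * (Fintype.card A + 3) / 2) ^ (2 * Fintype.card A) := by
  set P := boundedScales (Fintype.card A)
  calc (Delta R C).ncard
      ≤ (↑(Fintype.piFinset fun _ : A => P ×ˢ P) :
          Set (A → (Σ _ : ℕ, ℕ) × (Σ _ : ℕ, ℕ))).ncard := by
        refine Set.ncard_le_ncard_of_injOn (fun fQ a => (fQ a).scales) ?_ ?_
          (Finset.finite_toSet _)
        · intro fQ hfQ
          rw [Finset.mem_coe, Fintype.mem_piFinset]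
          intro a
          obtain ⟨hn, hm, -⟩ := hfQ a
          have hcard : (pre R a).card + 1 ≤ Fintype.card A + 1 :=
            Nat.succ_le_succ (Finset.card_le_univ _)
          exact Finset.mem_product.2 ⟨mem_boundedScales (fQ a).hn (hn.trans hcard),
            mem_boundedScales (fQ a).hm (hm.trans hcard)⟩
        · exact (Nuance.scales_injective.comp_left).injOn
    _ = ((Fintype.card A + 2) * (Fintype.card A + 3) / 2) ^ (2 * Fintype.card A) := by
        rw [Set.ncard_coe_finset, Fintype.card_piFinset, Finset.prod_const,
          Finset.card_univ, Finset.card_product, card_boundedScales, pow_mul, sq]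

/-- Cardinality of abstractions. -/
theorem delta_nonempty_and_card (R : A → A → Prop) [DecidableRel R]
    (C : ∀ a : A, (↥(pre R a) → Label) → Label) :
    (Delta R C).Nonempty ∧
      (Delta R C).ncard ≤
        ((Fintype.card A + 2) * (Fintype.card A + 3) / 2) ^ (2 * Fintype.card A) :=
  ⟨Delta_nonempty R C, ncard_Delta_le R C⟩
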